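/- arXiv:1210.2237 — 7 statements merged into one kernel-verified Lean document; each statement's English description precedes it below -/
import Mathlib

section
/- Let A be a C*-algebra and let τ be a bounded trace on A. Then there exists a bounded trace τ̃ on the multiplier algebra 𝓜(A) such that τ̃ ∘ ι = τ (where ι : A → 𝓜(A) is the canonical embedding), ‖τ̃‖ = ‖τ‖, and for every positive b ∈ 𝓜(A), τ̃(b) = sup { τ(a·b·a) : a ∈ A, a ≥ 0, ‖a‖ ≤ 1 } (here a·b·a is computed in 𝓜(A) and lies in the ideal A, so τ may be applied to it). -/
open Filter Topology MultiplierAlgebra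
open scoped ComplexOrder

namespace DoubleCentralizer

variable {A : Type*} [NonUnitalCStarAlgebra A]

lemma coe_fst_apply (m : 𝓜(ℂ, A)) (a : A) : ((m.fst a : A) : 𝓜(ℂ, A)) = m * (a : 𝓜(ℂ, A)) := by
  refine DoubleCentralizer.ext _ _ _ _ (Prod.ext ?_ ?_)
  · ext x
    have h : ∀ x y : A, m.fst x * y = m.fst (x * y) := by
      intro x y
      refine sub_eq_zero.1 (CStarRing.star_mul_self_eq_zero_iff _ |>.1 ?_)
      rw [mul_sub, ← m.central, ← mul_assoc, ← m.central, mul_assoc, sub_self]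
    simpa using h a x
  · ext x
    simpa using (m.central x a).symm

lemma mul_star_mul_self_fst (c : 𝓜(ℂ, A)) {a : A} (ha : star a = a) :
    a * (star c * c).fst a = star (c.fst a) * c.fst a := by
  have h := congrArg star (c.central (star (c.fst a)) a)
  simpa [ha] using h

lemma norm_mul_fst_le (m : 𝓜(ℂ, A)) {a : A} (ha : ‖a‖ ≤ 1) : ‖a * m.fst a‖ ≤ ‖m‖ := by
  have h : ‖m.fst a‖ ≤ ‖m‖ := by
    simpa [norm_fst] using m.fst.le_of_opNorm_le_of_le le_rfl ha
  calc ‖a * m.fst a‖ ≤ ‖a‖ * ‖m.fst a‖ := norm_mul_le _ _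
    _ ≤ 1 * ‖m‖ := by gcongr
    _ = ‖m‖ := one_mul _

lemma norm_coe_le (a : A) : ‖(a : 𝓜(ℂ, A))‖ ≤ ‖a‖ := by
  rw [← norm_fst, coe_fst]
  exact ContinuousLinearMap.opNorm_mul_apply_le ℂ A a

lemma coe_star (a : A) : ((star a : A) : 𝓜(ℂ, A)) = star (a : 𝓜(ℂ, A)) :=
  map_star (coeHom (𝕜 := ℂ) (A := A)) a

lemma coe_mul (a b : A) : ((a * b : A) : 𝓜(ℂ, A)) = (a : 𝓜(ℂ, A)) * (b : 𝓜(ℂ, A)) :=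
  map_mul (coeHom (𝕜 := ℂ) (A := A)) a b

end DoubleCentralizer

lemma CStarAlgebra.exists_one_sub_mul_star_eq_star_mul_self {B : Type*} [CStarAlgebra B] {a : B}
    (ha : ‖a‖ ≤ 1) : ∃ d : B, 1 - a * star a = star d * d := by
  let := CStarAlgebra.spectralOrder B
  have := CStarAlgebra.spectralOrderedRing B
  refine CStarAlgebra.nonneg_iff_eq_star_mul_self.1 (sub_nonneg.2 ?_)
  refine (CStarAlgebra.norm_le_one_iff_of_nonneg _ (mul_star_self_nonneg a)).1 ?_
  rw [CStarRing.norm_self_mul_star]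
  exact mul_le_one₀ ha (norm_nonneg _) ha

namespace DoubleCentralizer

/-- The compressions `m ↦ τ (a * m * a)` of a bounded functional `τ` converge pointwise, along an
ultrafilter finer than the approximate unit, to a functional on the multiplier algebra. -/
lemma exists_tendsto_compression {A : Type*} [NonUnitalCStarAlgebra A]
    [PartialOrder A] (τ : A →L[ℂ] ℂ) {l : Filter A}
    (hl : l.IsIncreasingApproximateUnit) :
    ∃ (U : Ultrafilter A) (φ : 𝓜(ℂ, A) →L[ℂ] ℂ), (U : Filter A) ≤ l ∧ ‖φ‖ ≤ ‖τ‖ ∧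
      ∀ m : 𝓜(ℂ, A), Tendsto (fun a : A ↦ τ (a * m.fst a)) U (𝓝 (φ m)) := by
  have := hl.neBot
  let U := Ultrafilter.of l
  have hU : (U : Filter A) ≤ l := Ultrafilter.of_le l
  have bound (m : 𝓜(ℂ, A)) : ∀ᶠ a in (U : Filter A), ‖τ (a * m.fst a)‖ ≤ ‖τ‖ * ‖m‖ := by
    filter_upwards [hU hl.eventually_norm] with a ha
    exact τ.le_of_opNorm_le_of_le le_rfl (norm_mul_fst_le m ha)
  have lim (m : 𝓜(ℂ, A)) : ∃ z : ℂ, Tendsto (fun a : A ↦ τ (a * m.fst a)) U (𝓝 z) := by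
    obtain ⟨z, -, hz⟩ := (isCompact_closedBall (0 : ℂ) (‖τ‖ * ‖m‖)).ultrafilter_le_nhds
      (U.map fun a : A ↦ τ (a * m.fst a)) (by
        rw [le_principal_iff]
        exact (bound m).mono fun a ha ↦ mem_closedBall_zero_iff.2 ha)
    exact ⟨z, hz⟩
  choose φ hφ using lim
  let Φ : 𝓜(ℂ, A) →ₗ[ℂ] ℂ :=
    { toFun := φ
      map_add' := fun x y ↦ tendsto_nhds_unique (hφ (x + y))
        (((hφ x).add (hφ y)).congr fun a ↦ by simp [mul_add])
      map_smul' := fun c x ↦ tendsto_nhds_unique (hφ (c • x))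
        (((hφ x).const_smul c).congr fun a ↦ by simp [mul_smul_comm]) }
  have hΦ (m : 𝓜(ℂ, A)) : ‖Φ m‖ ≤ ‖τ‖ * ‖m‖ := le_of_tendsto (hφ m).norm (bound m)
  exact ⟨U, Φ.mkContinuous ‖τ‖ hΦ, hU, Φ.mkContinuous_norm_le (norm_nonneg _) hΦ, hφ⟩

end DoubleCentralizer

/-- Every bounded trace `τ` on a C*-algebra `A` extends to a bounded trace
`τ'` on the multiplier algebra `𝓜(ℂ, A)` with `τ' ∘ ι = τ`, `‖τ'‖ = ‖τ‖`, and, for every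
positive `b ∈ 𝓜(ℂ, A)`,
`τ'(b) = sup { τ(a·b·a) : a ∈ A, a ≥ 0, ‖a‖ ≤ 1 }` (here `a·b·a = a * (b * a)` lies in `A`). -/
theorem exists_trace_extension_to_multiplierAlgebra
    {A : Type*} [NonUnitalCStarAlgebra A] [PartialOrder A] [StarOrderedRing A]
    (τ : A →L[ℂ] ℂ)
    (hτpos : ∀ x : A, 0 ≤ x → 0 ≤ τ x)
    (hτtr : ∀ x : A, τ (star x * x) = τ (x * star x)) :
    ∃ τ' : 𝓜(ℂ, A) →L[ℂ] ℂ,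
      (∀ x : 𝓜(ℂ, A), 0 ≤ τ' (star x * x)) ∧
      (∀ x : 𝓜(ℂ, A), τ' (star x * x) = τ' (x * star x)) ∧
      (∀ a : A, τ' (a : 𝓜(ℂ, A)) = τ a) ∧
      ‖τ'‖ = ‖τ‖ ∧
      ∀ b : 𝓜(ℂ, A), (∃ c : 𝓜(ℂ, A), b = star c * c) →
        τ' b = ((sSup {r : ℝ | ∃ a : A, 0 ≤ a ∧ ‖a‖ ≤ 1 ∧ r = (τ (a * b.fst a)).re} : ℝ) : ℂ) := by
  have hl := CStarAlgebra.increasingApproximateUnit A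
  obtain ⟨U, φ, hU, hnorm, hφ⟩ := DoubleCentralizer.exists_tendsto_compression τ hl
  have hsa : ∀ᶠ a in (U : Filter A), star a = a := hU hl.eventually_star_eq
  have hball : ∀ᶠ a in (U : Filter A), ‖a‖ ≤ 1 := hU hl.eventually_norm
  have hφpos (x : 𝓜(ℂ, A)) : 0 ≤ φ (star x * x) := by
    refine ge_of_tendsto (hφ _) ?_
    filter_upwards [hsa] with a ha
    rw [DoubleCentralizer.mul_star_mul_self_fst x ha]
    exact hτpos _ (star_mul_self_nonneg _)
  have hφext (a : A) : φ (a : 𝓜(ℂ, A)) = τ a := by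
    refine tendsto_nhds_unique (hφ _) ((τ.continuous.tendsto a).comp ?_)
    have h₁ : Tendsto (fun e : A ↦ a * e) U (𝓝 a) := (hl.tendsto_mul_left a).mono_left hU
    have h₂ : Tendsto (fun e : A ↦ e * a) U (𝓝 a) := (hl.tendsto_mul_right a).mono_left hU
    have h₃ : Tendsto (fun e : A ↦ e * (a * e - a)) U (𝓝 0) := by
      refine squeeze_zero_norm' ?_ (tendsto_iff_norm_sub_tendsto_zero.1 h₁)
      filter_upwards [hball] with e he
      exact (norm_mul_le _ _).trans (mul_le_of_le_one_left (norm_nonneg _) he)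
    simpa [mul_sub] using h₃.add h₂
  have hcomp (x : 𝓜(ℂ, A)) {a : A} (ha : star a = a) (ha' : ‖a‖ ≤ 1) :
      τ (a * (star x * x).fst a) ≤ φ (x * star x) := by
    obtain ⟨d, hd⟩ := CStarAlgebra.exists_one_sub_mul_star_eq_star_mul_self
      ((DoubleCentralizer.norm_coe_le a).trans ha')
    rw [DoubleCentralizer.mul_star_mul_self_fst x ha, hτtr, ← hφext, DoubleCentralizer.coe_mul,
      DoubleCentralizer.coe_star, DoubleCentralizer.coe_fst_apply, ← sub_nonneg, ← map_sub]
    convert! hφpos (d * star x) using 2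
    simp only [star_mul, star_star]
    rw [mul_assoc x (star d), ← mul_assoc (star d), ← hd]
    noncomm_ring
  have hle (x : 𝓜(ℂ, A)) : φ (star x * x) ≤ φ (x * star x) := by
    refine le_of_tendsto (hφ _) ?_
    filter_upwards [hsa, hball] with a ha ha' using hcomp x ha ha'
  have htr (x : 𝓜(ℂ, A)) : φ (star x * x) = φ (x * star x) :=
    (hle x).antisymm (by simpa using hle (star x))
  refine ⟨φ, hφpos, htr, hφext, hnorm.antisymm ?_, ?_⟩
  · refine τ.opNorm_le_bound (norm_nonneg _) fun a ↦ ?_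
    rw [← hφext]
    exact φ.le_of_opNorm_le_of_le le_rfl (DoubleCentralizer.norm_coe_le a)
  · rintro _ ⟨c, rfl⟩
    have hub : ∀ r ∈ {r : ℝ | ∃ a : A, 0 ≤ a ∧ ‖a‖ ≤ 1 ∧ r = (τ (a * (star c * c).fst a)).re},
        r ≤ (φ (star c * c)).re := by
      rintro _ ⟨a, ha, ha', rfl⟩
      rw [htr]
      exact (Complex.le_def.1 (hcomp c ha.isSelfAdjoint.star_eq ha')).1
    have hsup : IsLUB {r : ℝ | ∃ a : A, 0 ≤ a ∧ ‖a‖ ≤ 1 ∧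
        r = (τ (a * (star c * c).fst a)).re} (φ (star c * c)).re := by
      refine ⟨hub, fun s hs ↦ ?_⟩
      refine le_of_tendsto ((Complex.continuous_re.tendsto _).comp (hφ _)) ?_
      filter_upwards [hU hl.eventually_nonneg, hball] with a ha ha' using hs ⟨a, ha, ha', rfl⟩
    rw [hsup.csSup_eq ⟨_, 0, le_rfl, by simp, rfl⟩]
    exact Complex.ext rfl (Complex.le_def.1 (hφpos c)).2.symm
end

section
/- Let A be a C*-algebra, let τ be a bounded trace on A, and let (e_λ)_{λ ∈ Λ} be an approximate identity for A (a net of positive contractions in A, indexed by a directed set Λ, with ‖e_λ a − a‖ → 0 and ‖a e_λ − a‖ → 0 for every a ∈ A). Then for every positive b ∈ 𝓜(A), sup { τ(a·b·a) : a ∈ A, a ≥ 0, ‖a‖ ≤ 1 } = sup_{λ ∈ Λ} τ(e_λ · b · e_λ), where the products are computed in 𝓜(A) and lie in the ideal A. -/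
open Filter Topology MultiplierAlgebra
open scoped ComplexOrder

namespace DoubleCentralizer

section

variable {𝕜 A : Type*} [NontriviallyNormedField 𝕜] [NonUnitalNormedRing A]
  [NormedSpace 𝕜 A] [SMulCommClass 𝕜 A A] [IsScalarTower 𝕜 A A] [StarRing A] [CStarRing A]

/-- The left part of a double centralizer of a C⋆-ring is a map of right modules. -/
theorem fst_apply_mul (c : 𝓜(𝕜, A)) (x y : A) : c.fst (x * y) = c.fst x * y := by
  have h (w : A) : w * (c.fst (x * y) - c.fst x * y) = 0 := by
    rw [mul_sub, ← mul_assoc, ← c.central, ← c.central, mul_assoc, sub_self]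
  exact sub_eq_zero.mp (CStarRing.star_mul_self_eq_zero_iff _ |>.mp (h _))

end

/-- The identity `a (c⋆ c) a = (c a)⋆ (c a)` for selfadjoint `a`. -/
theorem mul_star_mul_self_fst_apply {𝕜 A : Type*} [NontriviallyNormedField 𝕜] [StarRing 𝕜]
    [NonUnitalNormedRing A] [NormedSpace 𝕜 A] [SMulCommClass 𝕜 A A] [IsScalarTower 𝕜 A A]
    [StarRing A] [StarModule 𝕜 A] [NormedStarGroup A]
    (c : 𝓜(𝕜, A)) {a : A} (ha : IsSelfAdjoint a) :
    a * (star c * c).fst a = star (c.fst a) * c.fst a := by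
  apply star_injective
  simp [star_mul, ha.star_eq, c.central]

end DoubleCentralizer

section Trace

variable {A : Type*} [NonUnitalCStarAlgebra A] [PartialOrder A] [StarOrderedRing A]

/-- For a trace `τ` and a contraction `a`, `τ((z a)⋆ (z a)) ≤ τ(z⋆ z)`. -/
theorem trace_re_star_mul_self_mul_le (τ : A →L[ℂ] ℂ)
    (hτpos : ∀ x : A, 0 ≤ x → 0 ≤ τ x) (hτtr : ∀ x : A, τ (star x * x) = τ (x * star x))
    (z : A) {a : A} (ha : ‖a‖ ≤ 1) :
    (τ (star (z * a) * (z * a))).re ≤ (τ (star z * z)).re := by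
  have hle : z * a * star (z * a) ≤ z * star z := by
    calc z * a * star (z * a) = z * (a * star a) * star z := by simp only [star_mul, mul_assoc]
      _ ≤ ‖a * star a‖ • (z * star z) :=
        CStarAlgebra.star_right_conjugate_le_norm_smul
      _ ≤ (1 : ℝ) • (z * star z) := by
        refine smul_le_smul_of_nonneg_right ?_ (mul_star_self_nonneg z)
        rw [CStarRing.norm_self_mul_star]
        exact mul_le_one₀ ha (norm_nonneg a) ha
      _ = z * star z := one_smul ℝ _
  have h := (Complex.le_def.mp (hτpos _ (sub_nonneg.mpr hle))).1
  rw [map_sub, Complex.sub_re, Complex.zero_re, sub_nonneg] at h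
  rwa [hτtr, hτtr]

end Trace

/-- For a bounded trace `τ` on `A`, an approximate identity `(e_λ)` of `A`
consisting of positive contractions, and a positive element `b` of the multiplier algebra,
`sup { τ(a·b·a) : a ∈ A, a ≥ 0, ‖a‖ ≤ 1 } = sup_λ τ(e_λ·b·e_λ)`. -/
theorem sSup_trace_eq_iSup_approxIdentity
    {A : Type*} [NonUnitalCStarAlgebra A] [PartialOrder A] [StarOrderedRing A]
    (τ : A →L[ℂ] ℂ)
    (hτpos : ∀ x : A, 0 ≤ x → 0 ≤ τ x)
    (hτtr : ∀ x : A, τ (star x * x) = τ (x * star x))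
    {Λ : Type*} [Nonempty Λ] [Preorder Λ] [IsDirected Λ (· ≤ ·)]
    (e : Λ → A) (hepos : ∀ l, 0 ≤ e l) (hecontr : ∀ l, ‖e l‖ ≤ 1)
    (happrox : ∀ a : A,
      Tendsto (fun l => ‖e l * a - a‖) atTop (𝓝 0) ∧
      Tendsto (fun l => ‖a * e l - a‖) atTop (𝓝 0))
    (b : 𝓜(ℂ, A)) (hb : ∃ c : 𝓜(ℂ, A), b = star c * c) :
    sSup {r : ℝ | ∃ a : A, 0 ≤ a ∧ ‖a‖ ≤ 1 ∧ r = (τ (a * b.fst a)).re}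
      = ⨆ l : Λ, (τ (e l * b.fst (e l))).re := by
  obtain ⟨c, rfl⟩ := hb
  have hform {a : A} (ha : 0 ≤ a) := c.mul_star_mul_self_fst_apply ha.isSelfAdjoint
  have hbound (a : A) (ha : 0 ≤ a) (ha1 : ‖a‖ ≤ 1) :
      (τ (a * (star c * c).fst a)).re ≤ ‖τ‖ * (‖c.fst‖ * ‖c.fst‖) := by
    have hc : ‖c.fst a‖ ≤ ‖c.fst‖ := c.fst.unit_le_opNorm a ha1
    calc (τ (a * (star c * c).fst a)).re ≤ ‖τ (star (c.fst a) * c.fst a)‖ := by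
          rw [hform ha]
          exact Complex.re_le_norm _
      _ ≤ ‖τ‖ * ‖star (c.fst a) * c.fst a‖ := τ.le_opNorm _
      _ ≤ ‖τ‖ * (‖c.fst‖ * ‖c.fst‖) := by
          rw [CStarRing.norm_star_mul_self]
          gcongr
  apply le_antisymm
  · refine csSup_le ⟨_, 0, le_rfl, by simp, rfl⟩ ?_
    rintro _ ⟨a, ha, ha1, rfl⟩
    have hlim : Tendsto
        (fun l => (τ (star (c.fst (e l * a)) * c.fst (e l * a))).re) atTop
        (𝓝 (τ (star (c.fst a) * c.fst a)).re) := by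
      have hcont : Continuous fun x : A => (τ (star (c.fst x) * c.fst x)).re := by fun_prop
      exact (hcont.tendsto a).comp (tendsto_iff_norm_sub_tendsto_zero.mpr (happrox a).1)
    rw [hform ha]
    refine le_of_tendsto' hlim fun l => ?_
    rw [c.fst_apply_mul]
    refine (trace_re_star_mul_self_mul_le τ hτpos hτtr _ ha1).trans ?_
    rw [← hform (hepos l)]
    refine le_ciSup (f := fun l => (τ (e l * (star c * c).fst (e l))).re)
      ⟨‖τ‖ * (‖c.fst‖ * ‖c.fst‖), ?_⟩ l
    rintro _ ⟨l, rfl⟩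
    exact hbound _ (hepos l) (hecontr l)
  · refine ciSup_le fun l =>
      le_csSup ⟨‖τ‖ * (‖c.fst‖ * ‖c.fst‖), ?_⟩ ⟨e l, hepos l, hecontr l, rfl⟩
    rintro _ ⟨a, ha, ha1, rfl⟩
    exact hbound a ha ha1
end

section
/- Let A be a C*-algebra, let τ be a bounded trace on A with ‖τ‖ = 1, and let a ∈ A be a positive contraction with τ(a) = 1. Then for every positive x ∈ A, τ(a^{1/2} · x · a^{1/2}) = τ(x), where a^{1/2} is given by nonunital continuous functional calculus applied to t ↦ √t. -/
open Filter Topology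
open scoped ComplexOrder

open scoped CStarAlgebra in
/-- For a positive contraction `a` and a contraction `y`, the element `w = (1 - a)^{1/2} y`, formed in
the unitization, lies in `A` and `a + w w*` is again a contraction. -/
lemma exists_star_mul_self_eq_sub_conjugate {A : Type*} [NonUnitalCStarAlgebra A] [PartialOrder A]
    [StarOrderedRing A] {a : A} (ha : 0 ≤ a) (ha1 : ‖a‖ ≤ 1) (y : A) (hy : ‖y‖ ≤ 1) :
    ∃ w : A, star w * w = star y * y - star y * a * y ∧ ‖a + w * star w‖ ≤ 1 := by
  have haU : (0 : Unitization ℂ A) ≤ a := Unitization.inr_nonneg_iff.mpr ha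
  have hle : (a : Unitization ℂ A) ≤ 1 :=
    (CStarAlgebra.norm_le_one_iff_of_nonneg (a : Unitization ℂ A) haU).mp
      (by rwa [Unitization.norm_inr])
  have hb0 : 0 ≤ 1 - (a : Unitization ℂ A) := sub_nonneg.mpr hle
  set b : Unitization ℂ A := CFC.sqrt (1 - (a : Unitization ℂ A))
  have hbb : b * b = 1 - (a : Unitization ℂ A) := CFC.sqrt_mul_sqrt_self _ hb0
  have hbs : star b = b := (IsSelfAdjoint.of_nonneg (CFC.sqrt_nonneg _)).star_eq
  obtain ⟨w, hw⟩ : ∃ w : A, (w : Unitization ℂ A) = b * y := by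
    refine ⟨(b * (y : Unitization ℂ A)).snd, ?_⟩
    ext <;> simp
  refine ⟨w, ?_, ?_⟩
  · apply Unitization.inr_injective (R := ℂ)
    simp only [Unitization.inr_mul, Unitization.inr_star, Unitization.inr_sub, hw, star_mul, hbs]
    rw [mul_assoc, ← mul_assoc b b, hbb]
    noncomm_ring
  · have hyy : (y : Unitization ℂ A) * star (y : Unitization ℂ A) ≤ 1 := by
      refine (CStarAlgebra.norm_le_one_iff_of_nonneg _ (mul_star_self_nonneg _)).mp ?_
      rw [CStarRing.norm_self_mul_star, Unitization.norm_inr]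
      exact mul_le_one₀ hy (norm_nonneg _) hy
    rw [← Unitization.norm_inr (𝕜 := ℂ)]
    have h0 : (0 : Unitization ℂ A) ≤ (a + w * star w : A) :=
      Unitization.inr_nonneg_iff.mpr (add_nonneg ha (mul_star_self_nonneg _))
    refine (CStarAlgebra.norm_le_one_iff_of_nonneg _ h0).mpr ?_
    have hc := star_left_conjugate_le_conjugate hyy b
    rw [hbs, mul_one, hbb] at hc
    simp only [Unitization.inr_add, Unitization.inr_mul, Unitization.inr_star, hw, star_mul, hbs]
    calc (a : Unitization ℂ A) + b * y * (star (y : Unitization ℂ A) * b)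
        = a + b * (y * star (y : Unitization ℂ A)) * b := by simp only [mul_assoc]
      _ ≤ a + (1 - a) := by gcongr
      _ = 1 := by abel

/-- A norm-one trace equal to one on a positive contraction `a` is unchanged by inserting `a`. -/
lemma trace_star_mul_mul_eq {A : Type*} [NonUnitalCStarAlgebra A] [PartialOrder A]
    [StarOrderedRing A] (τ : A →L[ℂ] ℂ) (hτpos : ∀ x : A, 0 ≤ x → 0 ≤ τ x)
    (hτtr : ∀ x : A, τ (star x * x) = τ (x * star x)) (hτnorm : ‖τ‖ = 1)
    {a : A} (ha : 0 ≤ a) (ha1 : ‖a‖ ≤ 1) (hτa : τ a = 1) (y : A) :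
    τ (star y * a * y) = τ (star y * y) := by
  have of_norm_le_one (y : A) (hy : ‖y‖ ≤ 1) : τ (star y * a * y) = τ (star y * y) := by
    obtain ⟨w, hw, hnorm⟩ := exists_star_mul_self_eq_sub_conjugate ha ha1 y hy
    have hpos : 0 ≤ τ (w * star w) := hτpos _ (mul_star_self_nonneg w)
    have hle : ‖τ (a + w * star w)‖ ≤ 1 := by
      simpa [hτnorm] using τ.le_of_opNorm_le_of_le hτnorm.le hnorm
    rw [map_add, hτa] at hle
    have hre : (1 + τ (w * star w)).re ≤ 1 := (Complex.re_le_norm _).trans hle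
    obtain ⟨h1, h2⟩ := Complex.le_def.mp hpos
    have hzero : τ (w * star w) = 0 := by
      apply Complex.ext
      · simp at hre h1 ⊢
        linarith
      · exact h2.symm
    rw [← hτtr, hw, map_sub, sub_eq_zero] at hzero
    exact hzero.symm
  have hr : (0 : ℝ) < ‖y‖ + 1 := by positivity
  have h := of_norm_le_one (((‖y‖ + 1 : ℝ) : ℂ)⁻¹ • y) (by
    rw [norm_smul, norm_inv, Complex.norm_real, Real.norm_of_nonneg hr.le, inv_mul_le_iff₀ hr]
    linarith)
  have hne : ((‖y‖ + 1 : ℝ) : ℂ) ≠ 0 := by exact_mod_cast hr.ne'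
  simp only [star_smul, smul_mul_assoc, mul_smul_comm, map_smul, smul_eq_mul] at h
  exact mul_left_cancel₀ (inv_ne_zero hne)
    (mul_left_cancel₀ (star_ne_zero.mpr (inv_ne_zero hne)) (by simpa only [mul_left_comm] using h))

/-- If `τ` is a bounded trace of norm one on a C*-algebra `A` and `a` is a
positive contraction with `τ(a) = 1`, then `τ(a^{1/2} x a^{1/2}) = τ(x)` for every positive
`x ∈ A`, where `a^{1/2} = cfcₙ Real.sqrt a`. -/
theorem trace_sqrt_conjugate_eq
    {A : Type*} [NonUnitalCStarAlgebra A] [PartialOrder A] [StarOrderedRing A]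
    (τ : A →L[ℂ] ℂ)
    (hτpos : ∀ x : A, 0 ≤ x → 0 ≤ τ x)
    (hτtr : ∀ x : A, τ (star x * x) = τ (x * star x))
    (hτnorm : ‖τ‖ = 1)
    (a : A) (hapos : 0 ≤ a) (hacontr : ‖a‖ ≤ 1) (hτa : τ a = 1)
    (x : A) (hx : 0 ≤ x) :
    τ (cfcₙ Real.sqrt a * x * cfcₙ Real.sqrt a) = τ x := by
  rw [← CFC.sqrt_eq_real_sqrt a hapos]
  have hs := (IsSelfAdjoint.of_nonneg (CFC.sqrt_nonneg a)).star_eq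
  have hy := (IsSelfAdjoint.of_nonneg (CFC.sqrt_nonneg x)).star_eq
  have hyy := CFC.sqrt_mul_sqrt_self x hx
  have hins := trace_star_mul_mul_eq τ hτpos hτtr hτnorm hapos hacontr hτa (CFC.sqrt x)
  calc τ (CFC.sqrt a * x * CFC.sqrt a)
      = τ (star (CFC.sqrt x * CFC.sqrt a) * (CFC.sqrt x * CFC.sqrt a)) := by
        rw [star_mul, hs, hy, mul_assoc, mul_assoc, ← mul_assoc (CFC.sqrt x), hyy]
    _ = τ (star (CFC.sqrt x) * a * CFC.sqrt x) := by
        rw [hτtr, star_mul, hs, mul_assoc, ← mul_assoc (CFC.sqrt a),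
          CFC.sqrt_mul_sqrt_self a hapos, hy, mul_assoc]
    _ = τ x := by rw [hins, hy, hyy]
end

section
/- Let A be a C*-algebra, let τ be a bounded trace on A with ‖τ‖ = 1, and let a ∈ A be a positive contraction with τ(a) = 1. Then for every continuous function f : [0,1] → ℝ with f ≥ 0 and f(0) = 0, one has τ(f(a)) = f(1), where f(a) is given by nonunital continuous functional calculus. -/
open Filter Topology
open scoped ComplexOrder

/-- A continuous function on `[0,1]` that vanishes at `1` is dominated by `ε + K * (1 - t)` for a
suitable constant `K`. -/
lemma exists_abs_le_add_mul_one_sub {g : ℝ → ℝ} (hg : ContinuousOn g (Set.Icc 0 1))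
    (hg1 : g 1 = 0) {ε : ℝ} (hε : 0 < ε) :
    ∃ K : ℝ, 0 < K ∧ ∀ t ∈ Set.Icc (0 : ℝ) 1, |g t| ≤ ε + K * (1 - t) := by
  obtain ⟨M, hM⟩ := isCompact_Icc.exists_bound_of_continuousOn hg
  obtain ⟨δ, hδ, h⟩ := Metric.continuousOn_iff.1 hg 1 (by simp) ε hε
  have hM0 : 0 ≤ M := (norm_nonneg _).trans (hM 1 (by simp))
  refine ⟨M / δ + 1, by positivity, fun t ht ↦ ?_⟩
  have hMδ : 0 ≤ M / δ := by positivity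
  rcases lt_or_ge (1 - t) δ with h1 | h1
  · have h2 := h t ht (by rw [Real.dist_eq, abs_sub_comm, abs_of_nonneg] <;> linarith [ht.2])
    rw [hg1, Real.dist_eq, sub_zero] at h2
    nlinarith [ht.2]
  · have h2 : M ≤ M / δ * (1 - t) := by
      calc M = M / δ * δ := by field_simp
        _ ≤ _ := by gcongr
    have h3 := hM t ht
    rw [Real.norm_eq_abs] at h3
    linarith [ht.2]

lemma quasispectrum_subset_Icc_of_nonneg_of_norm_le_one
    {A : Type*} [NonUnitalCStarAlgebra A] [PartialOrder A] [StarOrderedRing A]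
    {a : A} (ha : 0 ≤ a) (ha' : ‖a‖ ≤ 1) : quasispectrum ℝ a ⊆ Set.Icc 0 1 := fun x hx ↦
  ⟨quasispectrum_nonneg_of_nonneg a ha x hx,
    (le_abs_self x).trans ((NonUnitalIsometricContinuousFunctionalCalculus.norm_quasispectrum_le a hx).trans ha')⟩

/-- If `τ` is a bounded trace of norm one on a C*-algebra `A` and `a` is a
positive contraction with `τ(a) = 1`, then `τ(f(a)) = f(1)` for every continuous
`f : [0,1] → ℝ` with `f ≥ 0` and `f(0) = 0`, where `f(a)` is given by the nonunital
continuous functional calculus. -/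
theorem trace_cfcₙ_eq_eval_one
    {A : Type*} [NonUnitalCStarAlgebra A] [PartialOrder A] [StarOrderedRing A]
    (τ : A →L[ℂ] ℂ)
    (hτpos : ∀ x : A, 0 ≤ x → 0 ≤ τ x)
    (hτtr : ∀ x : A, τ (star x * x) = τ (x * star x))
    (hτnorm : ‖τ‖ = 1)
    (a : A) (hapos : 0 ≤ a) (hacontr : ‖a‖ ≤ 1) (hτa : τ a = 1)
    (f : ℝ → ℝ) (hf : ContinuousOn f (Set.Icc 0 1))
    (hfpos : ∀ t ∈ Set.Icc (0 : ℝ) 1, 0 ≤ f t) (hf0 : f 0 = 0) :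
    τ (cfcₙ f a) = (f 1 : ℂ) := by
  have hσ := quasispectrum_subset_Icc_of_nonneg_of_norm_le_one hapos hacontr
  have hfσ : ContinuousOn f (quasispectrum ℝ a) := hf.mono hσ
  obtain ⟨r, hr⟩ : ∃ r : ℝ, τ (cfcₙ f a) = r :=
    ⟨_, Complex.eq_re_of_ofReal_le (r := 0)
      (by simpa using hτpos _ (cfcₙ_nonneg fun x hx ↦ hfpos x (hσ hx)))⟩
  have hcfc (s : ℝ) : cfcₙ (fun t ↦ (1 - s * f 1) * t + s * f t) a =
      (1 - s * f 1) • a + s • cfcₙ f a := by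
    rw [cfcₙ_add (a := a) (fun t ↦ (1 - s * f 1) * t) (fun t ↦ s * f t), cfcₙ_const_mul_id _ a,
      cfcₙ_const_mul s f a]
  have hτ (s : ℝ) :
      τ (cfcₙ (fun t ↦ (1 - s * f 1) * t + s * f t) a) = ((1 + s * (r - f 1) : ℝ) : ℂ) := by
    rw [hcfc, map_add, ← Complex.coe_smul, ← Complex.coe_smul, map_smul, map_smul, hτa, hr]
    simp only [smul_eq_mul]
    push_cast
    ring
  rw [hr, Complex.ofReal_inj, ← sub_eq_zero, ← abs_nonpos_iff]
  refine le_of_forall_pos_le_add fun ε hε ↦ ?_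
  obtain ⟨K, hK, hbound⟩ := exists_abs_le_add_mul_one_sub (g := fun t ↦ f t - f 1 * t)
    (by fun_prop) (by simp) hε
  have key (s : ℝ) (hs : |s| = K⁻¹) : 1 + s * (r - f 1) ≤ 1 + K⁻¹ * ε := by
    have hnorm : ‖cfcₙ (fun t ↦ (1 - s * f 1) * t + s * f t) a‖ ≤ 1 + K⁻¹ * ε := by
      refine norm_cfcₙ_le fun t ht ↦ ?_
      obtain ⟨ht0, ht1⟩ := hσ ht
      calc ‖(1 - s * f 1) * t + s * f t‖ = |t + s * (f t - f 1 * t)| := by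
            rw [Real.norm_eq_abs]; ring_nf
        _ ≤ t + K⁻¹ * |f t - f 1 * t| := by
            refine (abs_add_le _ _).trans_eq ?_
            rw [abs_mul, hs, abs_of_nonneg ht0]
        _ ≤ t + K⁻¹ * (ε + K * (1 - t)) := by
            gcongr
            exact hbound t ⟨ht0, ht1⟩
        _ = 1 + K⁻¹ * ε := by field_simp; ring
    have h := τ.le_opNorm (cfcₙ (fun t ↦ (1 - s * f 1) * t + s * f t) a)
    rw [hτnorm, one_mul, hτ, Complex.norm_real] at h
    exact (le_abs_self _).trans (h.trans hnorm)
  have hK' : 0 < K⁻¹ := inv_pos.2 hK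
  have h1 := key K⁻¹ (abs_of_pos hK')
  have h2 := key (-K⁻¹) (by rw [abs_neg, abs_of_pos hK'])
  rw [zero_add, abs_le]
  constructor <;> refine le_of_mul_le_mul_left ?_ hK' <;> linarith
end

section
/- For every η > 0 there exist t̄ ∈ ℕ, continuous functions h^{(i)}_t : [0,1] → [0,1] with h^{(i)}_t(0) = 0, and scalars α^{(i)}_t ∈ (0,1], for i ∈ {1,2} and t ∈ {1,…,t̄}, such that: (a) for each fixed i, the functions h^{(i)}_1, …, h^{(i)}_{t̄} are pairwise orthogonal, i.e., h^{(i)}_t(s) · h^{(i)}_{t'}(s) = 0 for all s ∈ [0,1] whenever t ≠ t'; (b) sup_{s∈[0,1]} | s − Σ_{i=1,2} Σ_{t=1}^{t̄} α^{(i)}_t h^{(i)}_t(s) | ≤ η; and (c) for every continuous f : [0,1] → ℝ with f(0) = 0 and sup_{s∈[0,1]} |f(s)| ≤ 1, and for all i, t: sup_{s∈[0,1]} | f(h^{(i)}_t(s)) · s − α^{(i)}_t · f(h^{(i)}_t(s)) | ≤ η. -/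
open Filter Topology

/-- The hat function of height one centred at `c`, supported in `[c - 1, c + 1]`. -/
noncomputable def hat (c x : ℝ) : ℝ := max 0 (1 - |x - c|)

lemma continuous_hat (c : ℝ) : Continuous (hat c) := by
  unfold hat; fun_prop

lemma hat_mem_Icc (c x : ℝ) : hat c x ∈ Set.Icc (0 : ℝ) 1 :=
  ⟨le_max_left _ _, max_le zero_le_one (by linarith [abs_nonneg (x - c)])⟩

lemma hat_eq_zero {c x : ℝ} (h : 1 ≤ |x - c|) : hat c x = 0 :=
  max_eq_left (by linarith)

lemma hat_mul_hat_eq_zero {c d : ℝ} (h : 2 ≤ |c - d|) (x : ℝ) : hat c x * hat d x = 0 := by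
  rcases le_or_gt 1 |x - c| with hc | hc
  · rw [hat_eq_zero hc, zero_mul]
  · rw [hat_eq_zero (x := x) (c := d), mul_zero]
    have := abs_sub_le c x d
    rw [abs_sub_comm c x] at this
    linarith

/-- The piecewise linear interpolation of the identity at the nodes `0, …, n`, continued by `0`
from the node `n + 1` on. -/
lemma sum_range_mul_hat (n : ℕ) {x : ℝ} (hx : 0 ≤ x) :
    ∑ k ∈ Finset.range n, ((k : ℝ) + 1) * hat (k + 1) x =
      if x ≤ n then x else n * max 0 (n + 1 - x) := by
  induction n with
  | zero =>
    split_ifs with h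
    · simpa using le_antisymm hx (by simpa using h)
    · simp
  | succ n ih =>
    have hn : (0 : ℝ) ≤ n := n.cast_nonneg
    rw [Finset.sum_range_succ, ih]
    push_cast
    rcases le_or_gt x n with h | h
    · rw [if_pos h, if_pos (by linarith), hat_eq_zero, mul_zero, add_zero]
      rw [abs_of_nonpos (by linarith)]
      linarith
    rw [if_neg h.not_ge]
    rcases le_or_gt x (n + 1) with h' | h'
    · rw [if_pos h', hat, abs_of_nonpos (by linarith), max_eq_right (by linarith),
        max_eq_right (by linarith)]
      ring
    · rw [if_neg h'.not_ge, hat, abs_of_pos (by linarith), max_eq_left (by linarith), mul_zero,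
        zero_add]
      congr 2
      ring

lemma sum_range_two_mul {β : Type*} [AddCommMonoid β] (g : ℕ → β) (m : ℕ) :
    ∑ k ∈ Finset.range (2 * m), g k = ∑ i : Fin 2, ∑ t : Fin m, g (2 * t + i) := by
  rw [Fin.sum_univ_two, ← Finset.sum_add_distrib,
    Fin.sum_univ_eq_sum_range (fun t => g (2 * t + (0 : Fin 2)) + g (2 * t + (1 : Fin 2)))]
  induction m with
  | zero => simp
  | succ m ih =>
    rw [mul_add, Finset.sum_range_succ, Finset.sum_range_succ, ih, Finset.sum_range_succ, add_assoc]
    rfl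

/-- Approximate partition of the identity function on `[0,1]` by two
interleaved families of pairwise orthogonal bump functions vanishing at `0`: for every
`η > 0` there are `t̄ ∈ ℕ`, continuous `h^{(i)}_t : [0,1] → [0,1]` with `h^{(i)}_t(0) = 0`,
and scalars `α^{(i)}_t ∈ (0,1]` (for `i ∈ {1,2}`, `t ∈ {1,…,t̄}`) such that each family is
pairwise orthogonal, `s ≈_η Σ α^{(i)}_t h^{(i)}_t(s)`, and
`f(h^{(i)}_t(s))·s ≈_η α^{(i)}_t·f(h^{(i)}_t(s))` for all contractive continuous `f` with
`f(0) = 0`. -/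
theorem exists_orthogonal_approximate_partition (η : ℝ) (hη : 0 < η) :
    ∃ (tbar : ℕ) (h : Fin 2 → Fin tbar → ℝ → ℝ) (α : Fin 2 → Fin tbar → ℝ),
      (∀ i t, Continuous (h i t)) ∧
      (∀ i t, Set.MapsTo (h i t) (Set.Icc 0 1) (Set.Icc 0 1)) ∧
      (∀ i t, h i t 0 = 0) ∧
      (∀ i t, α i t ∈ Set.Ioc (0 : ℝ) 1) ∧
      (∀ i, ∀ t t', t ≠ t' → ∀ s ∈ Set.Icc (0 : ℝ) 1, h i t s * h i t' s = 0) ∧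
      (∀ s ∈ Set.Icc (0 : ℝ) 1, |s - ∑ i, ∑ t, α i t * h i t s| ≤ η) ∧
      (∀ f : ℝ → ℝ, ContinuousOn f (Set.Icc 0 1) → f 0 = 0 →
        (∀ s ∈ Set.Icc (0 : ℝ) 1, |f s| ≤ 1) →
        ∀ i t, ∀ s ∈ Set.Icc (0 : ℝ) 1,
          |f (h i t s) * s - α i t * f (h i t s)| ≤ η) := by
  obtain ⟨m, hm⟩ := exists_nat_gt (1 / η)
  have hm0 : (0 : ℝ) < m := (by positivity : 0 < 1 / η).trans hm
  set N : ℝ := ((2 * m : ℕ) : ℝ) with hN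
  have hN2 : N = 2 * m := by rw [hN]; push_cast; rfl
  have hN0 : 0 < N := by linarith
  have hNη : 1 / N ≤ η := by
    rw [div_le_iff₀ hN0, hN2]
    rw [div_lt_iff₀ hη] at hm
    nlinarith
  refine ⟨m, fun i t s => hat (((2 * t + i : ℕ) : ℝ) + 1) (N * s),
    fun i t => (((2 * t + i : ℕ) : ℝ) + 1) / N, ?_, ?_, ?_, ?_, ?_, ?_, ?_⟩
  · exact fun i t => (continuous_hat _).comp (by fun_prop)
  · exact fun i t s _ => hat_mem_Icc _ _
  · intro i t
    apply hat_eq_zero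
    rw [mul_zero, zero_sub, abs_neg, abs_of_nonneg (by positivity)]
    linarith [Nat.cast_nonneg (α := ℝ) (2 * t + i : ℕ)]
  · intro i t
    refine ⟨by positivity, (div_le_one hN0).2 ?_⟩
    rw [hN]
    exact_mod_cast (by omega : 2 * (t : ℕ) + i + 1 ≤ 2 * m)
  · intro i t t' htt s _
    apply hat_mul_hat_eq_zero
    have hone : (1 : ℝ) ≤ |(t : ℝ) - t'| := by
      have : (1 : ℤ) ≤ |((t : ℕ) : ℤ) - (t' : ℕ)| :=
        Int.one_le_abs (sub_ne_zero.2 (by exact_mod_cast Fin.val_ne_of_ne htt))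
      exact_mod_cast this
    have hdiff : ((2 * t + i : ℕ) : ℝ) + 1 - (((2 * t' + i : ℕ) : ℝ) + 1) =
        2 * ((t : ℝ) - t') := by
      push_cast
      ring
    rw [hdiff, abs_mul, abs_two]
    linarith
  · intro s hs
    have hsum : ∑ i : Fin 2, ∑ t : Fin m, (((2 * t + i : ℕ) : ℝ) + 1) / N *
        hat (((2 * t + i : ℕ) : ℝ) + 1) (N * s) = s := by
      rw [← sum_range_two_mul (fun k => ((k : ℝ) + 1) / N * hat ((k : ℝ) + 1) (N * s))]
      simp_rw [div_mul_eq_mul_div]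
      rw [← Finset.sum_div, sum_range_mul_hat _ (mul_nonneg hN0.le hs.1),
        if_pos (mul_le_of_le_one_right hN0.le hs.2), mul_div_cancel_left₀ _ hN0.ne']
    rw [hsum, sub_self, abs_zero]
    exact hη.le
  · intro f _ hf0 hf i t s _
    dsimp only
    generalize ((2 * t + i : ℕ) : ℝ) + 1 = c
    rcases le_or_gt 1 |N * s - c| with h | h
    · rw [hat_eq_zero h, hf0, zero_mul, mul_zero, sub_zero, abs_zero]
      exact hη.le
    · have hs : |s - c / N| ≤ 1 / N := by
        have : s - c / N = (N * s - c) / N := by field_simp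
        rw [this, abs_div, abs_of_pos hN0]
        gcongr
      rw [mul_comm (c / N), ← mul_sub, abs_mul]
      calc _ ≤ 1 * |s - c / N| := by gcongr; exact hf _ (hat_mem_Icc _ _)
        _ ≤ η := by rw [one_mul]; exact hs.trans hNη
end

section
/- Let A be a nonzero simple C*-algebra (its only closed two-sided ideals are {0} and A) that is σ-unital, i.e., contains a strictly positive element. Then there exists a nonzero positive element b ∈ A such that the hereditary subalgebra B := closure of { b·x·b : x ∈ A } is algebraically simple: the only two-sided ring ideals (not necessarily closed) of B are {0} and B. -/
open Filter Topology
open scoped ComplexOrder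

section CStar

variable {A : Type*} [NonUnitalCStarAlgebra A]

/-- The hereditary C*-subalgebra `closure (bAb)` generated by a self-adjoint element `b`. -/
def hereditaryStarSubalgebra (b : A) (hb : IsSelfAdjoint b) : NonUnitalStarSubalgebra ℂ A where
  carrier := closure {y : A | ∃ x : A, y = b * x * b}
  add_mem' hu hv := map_mem_closure₂ continuous_add hu hv <| by
    rintro _ ⟨x, rfl⟩ _ ⟨y, rfl⟩
    exact ⟨x + y, by rw [mul_add, add_mul]⟩
  zero_mem' := subset_closure ⟨0, by simp⟩
  mul_mem' hu hv := map_mem_closure₂ continuous_mul hu hv <| by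
    rintro _ ⟨x, rfl⟩ _ ⟨y, rfl⟩
    exact ⟨x * b * b * y, by simp only [mul_assoc]⟩
  smul_mem' c _ hu := map_mem_closure (f := (c • ·)) (continuous_const_smul c) hu <| by
    rintro _ ⟨x, rfl⟩
    exact ⟨c • x, by simp only [mul_smul_comm, smul_mul_assoc]⟩
  star_mem' hu := map_mem_closure (f := star) continuous_star hu <| by
    rintro _ ⟨x, rfl⟩
    exact ⟨star x, by simp [hb.star_eq, mul_assoc]⟩

lemma mem_hereditaryStarSubalgebra {b : A} {hb : IsSelfAdjoint b} {d : A} :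
    d ∈ hereditaryStarSubalgebra b hb ↔ d ∈ closure {y : A | ∃ x : A, y = b * x * b} :=
  Iff.rfl

lemma isClosed_hereditaryStarSubalgebra (b : A) (hb : IsSelfAdjoint b) :
    IsClosed (hereditaryStarSubalgebra b hb : Set A) :=
  isClosed_closure

/-- A hereditary subalgebra `B` satisfies `B A B ⊆ B`. -/
lemma mul_mul_mem_hereditaryStarSubalgebra {b : A} {hb : IsSelfAdjoint b} {d d' : A}
    (hd : d ∈ hereditaryStarSubalgebra b hb) (x : A) (hd' : d' ∈ hereditaryStarSubalgebra b hb) :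
    d * x * d' ∈ hereditaryStarSubalgebra b hb := by
  refine map_mem_closure₂ (f := fun d d' : A ↦ d * x * d') (by fun_prop) hd hd' ?_
  rintro _ ⟨y, rfl⟩ _ ⟨z, rfl⟩
  exact ⟨y * b * x * b * z, by simp only [mul_assoc]⟩

lemma mul_eq_self_of_mem_hereditaryStarSubalgebra {b c : A} {hb : IsSelfAdjoint b}
    (hc : c * b = b) {d : A} (hd : d ∈ hereditaryStarSubalgebra b hb) : c * d = d := by
  have hcl : IsClosed {d : A | c * d = d} := isClosed_eq (by fun_prop) continuous_id
  refine closure_minimal ?_ hcl hd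
  rintro _ ⟨x, rfl⟩
  simp only [Set.mem_ofPred_eq, ← mul_assoc, hc]

/-- A self-adjoint element of a C*-subalgebra is a difference of squares of its elements. -/
lemma IsSelfAdjoint.exists_eq_mul_self_sub_mul_self {S : NonUnitalStarSubalgebra ℂ A}
    (hS : IsClosed (S : Set A)) {a : A} (ha : IsSelfAdjoint a) (haS : a ∈ S) :
    ∃ y ∈ S, ∃ z ∈ S, a = y * y - z * z := by
  refine ⟨cfcₙ (fun t : ℝ ↦ √t) a, cfcₙ_mem (hs := hS) (𝕜' := ℂ) _ haS,
    cfcₙ (fun t : ℝ ↦ √(-t)) a, cfcₙ_mem (hs := hS) (𝕜' := ℂ) _ haS, ?_⟩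
  rw [← cfcₙ_mul _ _ a, ← cfcₙ_mul _ _ a, ← cfcₙ_sub _ _ a]
  conv_lhs => rw [← cfcₙ_id' ℝ a]
  congr 1
  ext t
  rcases le_total 0 t with ht | ht
  · rw [Real.mul_self_sqrt ht, Real.sqrt_eq_zero_of_nonpos (by linarith)]
    ring
  · rw [Real.mul_self_sqrt (by linarith : 0 ≤ -t), Real.sqrt_eq_zero_of_nonpos ht]
    ring

/-- A dense two-sided ideal contains every element on which one of the elements of the algebra
acts as a left unit. -/
lemma Submodule.mem_of_dense_of_mul_eq_self {I : Submodule ℂ A}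
    (hI : Dense (I : Set A)) (hl : ∀ x, ∀ s ∈ I, x * s ∈ I) (hr : ∀ s ∈ I, ∀ x, s * x ∈ I)
    {c c' : A} (hc : c * c' = c') : c' ∈ I := by
  obtain ⟨j, hj, hjc⟩ := Metric.dense_iff.mp hI c 1 one_pos
  rw [Metric.mem_ball, dist_comm, dist_eq_norm] at hj
  have hu : IsUnit (1 - ((c - j : A) : Unitization ℂ A)) :=
    isUnit_one_sub_of_norm_lt_one (by rwa [Unitization.norm_inr])
  obtain ⟨v, hv⟩ := hu.exists_left_inv
  have hjc' : (1 - ((c - j : A) : Unitization ℂ A)) * (c' : Unitization ℂ A) =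
      ((j * c' : A) : Unitization ℂ A) := by
    rw [sub_mul, one_mul, ← Unitization.inr_mul, ← Unitization.inr_sub, sub_mul, hc,
      sub_sub_cancel]
  have hvc : (c' : Unitization ℂ A) = v * ((j * c' : A) : Unitization ℂ A) := by
    rw [← hjc', ← mul_assoc, hv, one_mul]
  have hsnd := congrArg (fun w : Unitization ℂ A ↦ w.snd) hvc
  simp only [Unitization.snd_inr, Unitization.snd_mul, Unitization.fst_inr, zero_smul,
    add_zero] at hsnd
  rw [hsnd]
  have hjI := hr j hjc c'
  simpa using I.add_mem (I.smul_mem v.fst hjI) (hl v.snd _ hjI)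

lemma IsSelfAdjoint.mul_self_ne_zero {p : A} (hp : IsSelfAdjoint p) (h : p ≠ 0) :
    p * p ≠ 0 := by
  nth_rw 1 [← hp.star_eq]
  exact CStarRing.star_mul_self_ne_zero_iff p |>.mpr h

/-- In a simple C*-algebra, the two-sided ideal `span (A q A)` is dense as soon as it is
nonzero. -/
lemma dense_span_mul_mul_of_simple
    (hsimple : ∀ I : TwoSidedIdeal A, IsClosed (I : Set A) → I = ⊥ ∨ I = ⊤)
    {q x y : A} (h : x * q * y ≠ 0) :
    Dense (Submodule.span ℂ {s : A | ∃ x y, s = x * q * y} : Set A) ∧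
    (∀ x, ∀ s ∈ Submodule.span ℂ {s : A | ∃ x y, s = x * q * y},
      x * s ∈ Submodule.span ℂ {s : A | ∃ x y, s = x * q * y}) ∧
    ∀ s ∈ Submodule.span ℂ {s : A | ∃ x y, s = x * q * y}, ∀ x,
      s * x ∈ Submodule.span ℂ {s : A | ∃ x y, s = x * q * y} := by
  set I := Submodule.span ℂ {s : A | ∃ x y, s = x * q * y} with hI
  have hl : ∀ x, ∀ s ∈ I, x * s ∈ I := fun z s hs ↦ by
    have : I ≤ I.comap (LinearMap.mulLeft ℂ z) := Submodule.span_le.mpr <| by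
      rintro _ ⟨x, y, rfl⟩
      exact Submodule.subset_span ⟨z * x, y, by simp [mul_assoc]⟩
    exact this hs
  have hr : ∀ s ∈ I, ∀ x, s * x ∈ I := fun s hs z ↦ by
    have : I ≤ I.comap (LinearMap.mulRight ℂ z) := Submodule.span_le.mpr <| by
      rintro _ ⟨x, y, rfl⟩
      exact Submodule.subset_span ⟨x, y * z, by simp [mul_assoc]⟩
    exact this hs
  refine ⟨?_, hl, hr⟩
  let K : TwoSidedIdeal A := TwoSidedIdeal.mk' (I.topologicalClosure : Set A)
    (zero_mem _) (fun hx hy ↦ add_mem hx hy) (fun hx ↦ neg_mem hx)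
    (fun {x _} hy ↦ map_mem_closure (continuous_const_mul x) hy (hl x))
    (fun {_ y} hx ↦ map_mem_closure (f := (· * y)) (continuous_mul_const y) hx fun s hs ↦ hr s hs y)
  have hK : (K : Set A) = I.topologicalClosure := by
    ext z
    simp [K]
  rcases hsimple K (hK ▸ I.isClosed_topologicalClosure) with hbot | htop
  · refine absurd ?_ h
    have : x * q * y ∈ (K : Set A) :=
      hK ▸ I.le_topologicalClosure (Submodule.subset_span ⟨x, y, rfl⟩)
    rwa [hbot] at this
  · intro z
    have : z ∈ (K : Set A) := by simp [htop]
    rwa [hK] at this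

/-- A nonzero C*-algebra contains a positive `b ≠ 0` and elements `c'`, `c` such that `c'` acts as
a left unit on `b` and `c` acts as a left unit on `c'`. -/
lemma exists_nonneg_ne_zero_chain [PartialOrder A] [StarOrderedRing A] [Nontrivial A] :
    ∃ b c' c : A, 0 ≤ b ∧ b ≠ 0 ∧ c' * b = b ∧ c * c' = c' := by
  obtain ⟨x, hx⟩ := exists_ne (0 : A)
  have hxx : star x * x ≠ 0 := CStarRing.star_mul_self_ne_zero_iff x |>.mpr hx
  obtain ⟨e, he, hnorm⟩ : ∃ e : A, IsSelfAdjoint e ∧ 0 ≤ e ∧ ‖e‖ = 3 := by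
    refine ⟨(3 / ‖star x * x‖ : ℝ) • (star x * x), (IsSelfAdjoint.all _).smul (.star_mul_self x),
      smul_nonneg (by positivity) (star_mul_self_nonneg x), ?_⟩
    rw [norm_smul, Real.norm_of_nonneg (by positivity)]
    exact div_mul_cancel₀ _ (norm_ne_zero_iff.mpr hxx)
  refine ⟨cfcₙ (fun t : ℝ ↦ max 0 (t - 2)) e, cfcₙ (fun t : ℝ ↦ min 1 (max 0 (t - 1))) e,
    cfcₙ (fun t : ℝ ↦ min 1 t) e, cfcₙ_nonneg fun _ _ ↦ le_max_left _ _, ?_, ?_, ?_⟩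
  · intro h0
    have hle : ‖cfcₙ (fun t : ℝ ↦ t) e‖ ≤ 2 := by
      refine norm_cfcₙ_le fun t ht ↦ ?_
      have h1 := norm_apply_le_norm_cfcₙ (fun t : ℝ ↦ max 0 (t - 2)) e ht (by fun_prop)
        (by norm_num) he
      rw [h0, norm_zero, Real.norm_of_nonneg (le_max_left _ _)] at h1
      have h2 := quasispectrum_nonneg_of_nonneg e hnorm.1 t ht
      rw [Real.norm_of_nonneg h2]
      linarith [le_max_right 0 (t - 2)]
    rw [cfcₙ_id' ℝ e, hnorm.2] at hle
    norm_num at hle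
  · rw [← cfcₙ_mul _ _ e (by fun_prop) (by norm_num) (by fun_prop) (by norm_num)]
    congr 1
    ext t
    rcases le_total t 2 with ht | ht
    · rw [max_eq_left (by linarith : t - 2 ≤ 0), mul_zero]
    · rw [min_eq_left (le_max_of_le_right (by linarith)), one_mul]
  · rw [← cfcₙ_mul _ _ e (by fun_prop) (by norm_num) (by fun_prop) (by norm_num)]
    congr 1
    ext t
    rcases le_total t 1 with ht | ht
    · rw [max_eq_left (by linarith : t - 1 ≤ 0), min_eq_right zero_le_one, mul_zero]
    · rw [min_eq_left ht, one_mul]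

end CStar

/-- Every nonzero simple σ-unital C*-algebra `A` (simple: the only closed
two-sided ideals are `{0}` and `A`) contains a nonzero positive element `b` such that the
hereditary subalgebra `B = closure (bAb)` is algebraically simple: the only two-sided ring
ideals (not necessarily closed) of `B` are `{0}` and `B`. -/
theorem exists_algebraically_simple_hereditary_subalgebra
    {A : Type*} [NonUnitalCStarAlgebra A] [PartialOrder A] [StarOrderedRing A]
    [Nontrivial A]
    (hsimple : ∀ I : TwoSidedIdeal A, IsClosed (I : Set A) → I = ⊥ ∨ I = ⊤)
    (hσunital : ∃ e : A, 0 ≤ e ∧ Dense {y : A | ∃ x : A, y = e * x}) :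
    ∃ b : A, 0 ≤ b ∧ b ≠ 0 ∧
      ∀ J : Set A, J ⊆ closure {y : A | ∃ x : A, y = b * x * b} →
        (0 : A) ∈ J →
        (∀ u ∈ J, ∀ v ∈ J, u + v ∈ J) →
        (∀ u ∈ J, -u ∈ J) →
        (∀ u ∈ J, ∀ c ∈ closure {y : A | ∃ x : A, y = b * x * b}, c * u ∈ J ∧ u * c ∈ J) →
        J = {0} ∨ J = closure {y : A | ∃ x : A, y = b * x * b} := by
  obtain ⟨b, c', c, hb, hb0, hc'b, hcc'⟩ := exists_nonneg_ne_zero_chain (A := A)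
  refine ⟨b, hb, hb0, fun J hJB h0 hadd hneg hmul ↦ ?_⟩
  have hbsa : IsSelfAdjoint b := .of_nonneg hb
  set B := hereditaryStarSubalgebra b hbsa with hB
  by_cases hJ : ∃ u ∈ J, u ≠ 0
  swap
  · push Not at hJ
    exact .inl (Set.eq_singleton_iff_unique_mem.mpr ⟨h0, hJ⟩)
  right
  refine hJB.antisymm ?_
  obtain ⟨u, huJ, hu0⟩ := hJ
  have huB : u ∈ B := hJB huJ
  obtain ⟨p, hpJ, hpsa, hp0⟩ : ∃ p ∈ J, IsSelfAdjoint p ∧ p ≠ 0 :=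
    ⟨u * star u, (hmul u huJ _ (star_mem huB)).2, .mul_star_self u,
      CStarRing.mul_star_self_ne_zero_iff u |>.mpr hu0⟩
  have hpB : p ∈ B := hJB hpJ
  have hp8 : p * (p * p * p) * (p * p * p * p) ≠ 0 := by
    have h2 : IsSelfAdjoint (p * p) := by simp [IsSelfAdjoint, star_mul, hpsa.star_eq]
    have h4 := h2.mul_self_ne_zero (hpsa.mul_self_ne_zero hp0)
    have h4sa : IsSelfAdjoint (p * p * (p * p)) := by
      simp [IsSelfAdjoint, star_mul, hpsa.star_eq]
    simpa only [mul_assoc] using h4sa.mul_self_ne_zero h4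
  obtain ⟨hdense, hl, hr⟩ := dense_span_mul_mul_of_simple hsimple hp8
  have hc'I := Submodule.mem_of_dense_of_mul_eq_self hdense hl hr hcc'
  have hsand : ∀ s ∈ Submodule.span ℂ {s : A | ∃ x y, s = x * (p * p * p) * y},
      ∀ d ∈ B, ∀ d' ∈ B, d * s * d' ∈ J := by
    intro s hs
    induction hs using Submodule.span_induction with
    | mem s hs =>
      obtain ⟨x, y, rfl⟩ := hs
      intro d hd d' hd'
      have h1 := (hmul p hpJ _ (mul_mul_mem_hereditaryStarSubalgebra hd x hpB)).1
      have h2 := (hmul _ h1 _ (mul_mul_mem_hereditaryStarSubalgebra hpB y hd')).2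
      simpa only [mul_assoc] using h2
    | zero => simpa using fun _ _ _ _ ↦ h0
    | add s t _ _ hs ht =>
      intro d hd d' hd'
      simpa only [mul_add, add_mul] using hadd _ (hs d hd d' hd') _ (ht d hd d' hd')
    | smul k s _ hs =>
      intro d hd d' hd'
      simpa only [mul_smul_comm, smul_mul_assoc] using hs (k • d) (SMulMemClass.smul_mem k hd) d' hd'
  have hprod : ∀ d ∈ B, ∀ d' ∈ B, d * d' ∈ J := fun d hd d' hd' ↦ by
    have := hsand c' hc'I d hd d' hd'
    rwa [mul_assoc, mul_eq_self_of_mem_hereditaryStarSubalgebra hc'b hd'] at this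
  have hsa : ∀ k : ℂ, ∀ a ∈ B, IsSelfAdjoint a → k • a ∈ J := by
    intro k a haB ha
    obtain ⟨y, hy, z, hz, rfl⟩ :=
      ha.exists_eq_mul_self_sub_mul_self (isClosed_hereditaryStarSubalgebra b hbsa) haB
    rw [smul_sub, sub_eq_add_neg, ← smul_mul_assoc, ← smul_mul_assoc]
    exact hadd _ (hprod _ (SMulMemClass.smul_mem k hy) _ hy) _
      (hneg _ (hprod _ (SMulMemClass.smul_mem k hz) _ hz))
  intro d hd
  have hdB : d ∈ B := hd
  have hre : (realPart d : A) ∈ B := by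
    rw [realPart_apply_coe, ← Complex.coe_smul]
    exact SMulMemClass.smul_mem _ (add_mem hdB (star_mem hdB))
  have him : (imaginaryPart d : A) ∈ B := by
    rw [imaginaryPart_apply_coe, ← Complex.coe_smul]
    exact SMulMemClass.smul_mem _ (SMulMemClass.smul_mem _ (sub_mem hdB (star_mem hdB)))
  rw [← realPart_add_I_smul_imaginaryPart d]
  refine hadd _ ?_ _ (hsa _ _ him (imaginaryPart d).2)
  simpa using hsa 1 _ hre (realPart d).2
end

section
/- Let A be a σ-unital C*-algebra (containing a strictly positive element) in which every dense two-sided ring ideal equals A (equivalently, A coincides with its Pedersen ideal). If a ∈ A is a positive element that is full in A (the smallest closed two-sided ideal of A containing a is all of A), then there exists c > 0 such that τ(a) ≥ c for every bounded trace τ on A with ‖τ‖ = 1; in particular inf_{τ ∈ T¹(A)} τ(a) > 0. -/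
open Filter Topology
open scoped ComplexOrder

namespace BoundedTrace

variable {A : Type*} [NonUnitalCStarAlgebra A]

/-- The closure of a two-sided ideal of a non-unital C*-algebra. -/
def closureIdeal (I : TwoSidedIdeal A) : TwoSidedIdeal A :=
  TwoSidedIdeal.mk' (closure (I : Set A))
    (subset_closure I.zero_mem)
    (fun hx hy => map_mem_closure₂ continuous_add hx hy fun _ ha _ hb => I.add_mem ha hb)
    (fun hx => map_mem_closure continuous_neg hx fun _ ha => I.neg_mem ha)
    (fun {x _} hy => map_mem_closure (continuous_const_mul x) hy
      fun _ hb => I.mul_mem_left _ _ hb)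
    (fun {_ y} hx => map_mem_closure (f := fun b => b * y) (continuous_mul_const y) hx
      fun _ ha => I.mul_mem_right _ _ ha)

theorem coe_closureIdeal (I : TwoSidedIdeal A) :
    (closureIdeal I : Set A) = closure (I : Set A) :=
  TwoSidedIdeal.coe_mk' ..

/-- A linear functional with `τ (x⋆ x) = τ (x x⋆)` satisfies `τ (x y) = τ (y x)`. -/
theorem map_mul_comm {τ : A →L[ℂ] ℂ} (hτ : ∀ x : A, τ (star x * x) = τ (x * star x))
    (x y : A) : τ (x * y) = τ (y * x) := by
  have h1 := hτ (star x + y)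
  have h2 := hτ (star x + Complex.I • y)
  have h3 := hτ (star x)
  have h4 := hτ y
  simp only [star_add, star_star, star_smul, mul_add, add_mul, map_add, smul_mul_assoc,
    mul_smul_comm, map_smul, smul_eq_mul, Complex.star_def, Complex.conj_I] at h1 h2 h3 h4
  linear_combination (1 / 2 : ℂ) * h1 - (Complex.I / 2) * h2 + (-1 + Complex.I) / 2 * h3
    + (-1 + Complex.I) / 2 * h4
    + ((τ (star x * star y) - τ (star y * star x) - τ (y * x) + τ (x * y)) / 2
      + Complex.I / 2 * (τ (y * star y) - τ (star y * y))) * Complex.I_sq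

variable [PartialOrder A]

/-- The bounded traces on `A`. -/
def boundedTraces (A : Type*) [NonUnitalCStarAlgebra A] [PartialOrder A] : Set (A →L[ℂ] ℂ) :=
  {τ | (∀ x : A, 0 ≤ x → 0 ≤ τ x) ∧ ∀ x : A, τ (star x * x) = τ (x * star x)}

/-- `b` is dominated by `a` if, up to a constant, `|τ b| ≤ τ a` for all bounded traces `τ`. -/
def Dominated (a b : A) : Prop :=
  ∃ K : ℝ, ∀ τ ∈ boundedTraces A, ‖τ b‖ ≤ K * (τ a).re

namespace Dominated

variable {a b c : A}

protected theorem zero : Dominated a 0 := ⟨0, fun τ _ => by simp⟩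

protected theorem add (hb : Dominated a b) (hc : Dominated a c) : Dominated a (b + c) := by
  obtain ⟨K, hK⟩ := hb
  obtain ⟨L, hL⟩ := hc
  refine ⟨K + L, fun τ hτ => ?_⟩
  rw [map_add, add_mul]
  exact (norm_add_le _ _).trans (add_le_add (hK τ hτ) (hL τ hτ))

protected theorem smul (z : ℂ) (hb : Dominated a b) : Dominated a (z • b) := by
  obtain ⟨K, hK⟩ := hb
  refine ⟨‖z‖ * K, fun τ hτ => ?_⟩
  rw [map_smul, norm_smul, mul_assoc]
  exact mul_le_mul_of_nonneg_left (hK τ hτ) (norm_nonneg z)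

protected theorem neg (hb : Dominated a b) : Dominated a (-b) := by
  simpa using hb.smul (-1)

theorem mul_comm (h : Dominated a (b * c)) : Dominated a (c * b) := by
  obtain ⟨K, hK⟩ := h
  exact ⟨K, fun τ hτ => map_mul_comm hτ.2 b c ▸ hK τ hτ⟩

variable [StarOrderedRing A]

theorem of_nonneg_of_le_smul {r : ℝ} (hb : 0 ≤ b) (hba : b ≤ r • a) : Dominated a b := by
  refine ⟨r, fun τ hτ => ?_⟩
  have h1 := hτ.1 b hb
  have h2 := hτ.1 _ (sub_nonneg.2 hba)
  rw [← Complex.coe_smul, map_sub, map_smul, smul_eq_mul, sub_nonneg] at h2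
  rw [← Complex.re_eq_norm.2 h1]
  simpa using (Complex.le_def.1 h2).1

protected theorem refl (ha : 0 ≤ a) : Dominated a a :=
  of_nonneg_of_le_smul (r := 1) ha (by simp)

theorem mul_left_self (ha : 0 ≤ a) (x : A) : Dominated a (x * a) := by
  have hx : x ∈ Submodule.span ℂ {y : A | 0 ≤ y} := by simp [CStarAlgebra.span_nonneg]
  induction hx using Submodule.span_induction with
  | mem x hx =>
    set s := CFC.sqrt a with hs
    have hs0 : 0 ≤ s := CFC.sqrt_nonneg a
    have hsa : s * s = a := CFC.sqrt_mul_sqrt_self a ha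
    have hss : star s = s := (IsSelfAdjoint.of_nonneg hs0).star_eq
    have h1 : 0 ≤ s * x * s := by simpa [hss] using star_left_conjugate_nonneg hx s
    have h2 : s * x * s ≤ ‖x‖ • a := by
      simpa [hss, hsa] using
        CStarAlgebra.star_left_conjugate_le_norm_smul (a := s) (b := x)
          (IsSelfAdjoint.of_nonneg hx)
    have h3 : Dominated a (s * (x * s)) := mul_assoc s x s ▸ of_nonneg_of_le_smul h1 h2
    simpa [mul_assoc, hsa] using h3.mul_comm
  | zero => simpa using Dominated.zero
  | add x y _ _ hx hy => simpa [add_mul] using hx.add hy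
  | smul z x _ hx => simpa [smul_mul_assoc] using hx.smul z

end Dominated

/-- The elements `b` such that `b` and all its left multiples are dominated by `a` form a
two-sided ideal. -/
def dominatedIdeal (a : A) : TwoSidedIdeal A :=
  TwoSidedIdeal.mk' {b | Dominated a b ∧ ∀ x, Dominated a (x * b)}
    ⟨.zero, fun x => by simpa using Dominated.zero⟩
    (fun hb hc => ⟨hb.1.add hc.1, fun x => by simpa [mul_add] using (hb.2 x).add (hc.2 x)⟩)
    (fun hb => ⟨hb.1.neg, fun x => by simpa using (hb.2 x).neg⟩)
    (fun {x _} hb => ⟨hb.2 x, fun y => by simpa [mul_assoc] using hb.2 (y * x)⟩)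
    (fun {_ y} hb => ⟨(hb.2 y).mul_comm, fun x => by
      have h := hb.2 (y * x)
      rw [mul_assoc] at h
      simpa [mul_assoc] using h.mul_comm⟩)

theorem mem_dominatedIdeal {a b : A} :
    b ∈ dominatedIdeal a ↔ Dominated a b ∧ ∀ x, Dominated a (x * b) :=
  TwoSidedIdeal.mem_mk' ..

end BoundedTrace

open BoundedTrace in
/-- Let `A` be a σ-unital C*-algebra in which every dense two-sided ring
ideal equals `A` (i.e. `A` coincides with its Pedersen ideal).  If `a ∈ A` is a full positive
element, then there is `c > 0` with `τ(a) ≥ c` for every bounded trace `τ` on `A` of norm one;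
in particular `inf_{τ ∈ T¹(A)} τ(a) > 0`. -/
theorem full_positive_element_trace_bounded_below
    {A : Type*} [NonUnitalCStarAlgebra A] [PartialOrder A] [StarOrderedRing A]
    (hσunital : ∃ e : A, 0 ≤ e ∧ Dense {y : A | ∃ x : A, y = e * x})
    (hPedersen : ∀ I : TwoSidedIdeal A, Dense (I : Set A) → I = ⊤)
    (a : A) (hapos : 0 ≤ a)
    (hfull : ∀ I : TwoSidedIdeal A, IsClosed (I : Set A) → a ∈ I → I = ⊤) :
    ∃ c : ℝ, 0 < c ∧
      ∀ τ : A →L[ℂ] ℂ,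
        (∀ x : A, 0 ≤ x → 0 ≤ τ x) →
        (∀ x : A, τ (star x * x) = τ (x * star x)) →
        ‖τ‖ = 1 →
        c ≤ (τ a).re := by
  have hmem : a ∈ dominatedIdeal a :=
    mem_dominatedIdeal.2 ⟨.refl hapos, Dominated.mul_left_self hapos⟩
  have hclosure : closureIdeal (dominatedIdeal a) = ⊤ := by
    refine hfull _ ?_ ?_
    · rw [coe_closureIdeal]
      exact isClosed_closure
    · rw [← SetLike.mem_coe, coe_closureIdeal]
      exact subset_closure hmem
  have htop : dominatedIdeal a = ⊤ := by
    refine hPedersen _ (dense_iff_closure_eq.2 ?_)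
    rw [← coe_closureIdeal, hclosure, TwoSidedIdeal.coe_top]
  have hdom (b : A) : Dominated a b :=
    (mem_dominatedIdeal.1 (htop ▸ TwoSidedIdeal.mem_top A : b ∈ dominatedIdeal a)).1
  have hre (τ : boundedTraces A) : 0 ≤ (τ.1 a).re := (Complex.le_def.1 (τ.2.1 a hapos)).1
  obtain ⟨C, hC⟩ := banach_steinhaus
    (g := fun τ : boundedTraces A => (((τ.1 a).re⁻¹ : ℝ) : ℂ) • τ.1) (fun b => by
      obtain ⟨K, hK⟩ := hdom b
      refine ⟨|K|, fun τ => ?_⟩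
      rw [smul_apply, norm_smul, Complex.norm_real,
        Real.norm_of_nonneg (inv_nonneg.2 (hre τ))]
      refine inv_mul_le_of_le_mul₀ (hre τ) (abs_nonneg K) ?_
      rw [mul_comm]
      exact (hK τ.1 τ.2).trans (mul_le_mul_of_nonneg_right (le_abs_self K) (hre τ)))
  refine ⟨(max C 1)⁻¹, by positivity, fun τ hpos htr hnorm => ?_⟩
  have hτ : τ ∈ boundedTraces A := ⟨hpos, htr⟩
  have hτa : 0 < (τ a).re := by
    refine (hre ⟨τ, hτ⟩).lt_of_ne fun h => ?_
    have hzero : τ = 0 := by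
      ext b
      obtain ⟨K, hK⟩ := hdom b
      simpa [← h] using hK τ hτ
    simp [hzero] at hnorm
  have hb := hC ⟨τ, hτ⟩
  rw [norm_smul, hnorm, mul_one, Complex.norm_real,
    Real.norm_of_nonneg (inv_nonneg.2 hτa.le)] at hb
  exact inv_le_of_inv_le₀ hτa (hb.trans (le_max_left C 1))
end
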